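/- arXiv:2004.06807 — 2 statements merged into one kernel-verified Lean document; each statement's English description precedes it below -/
import Mathlib

section
/- Let k < 0, γ > 0, β ≥ 0, and set λ = (β + √(β² - 4kγ))/2 and μ = (-β + √(β² - 4kγ))/2. Let p, q : [0, ∞) → ℝ be differentiable with p'(t) = k - kγ q(t) and q'(t) = p(t) - β q(t) for all t ≥ 0. If q(0) > 0 and p(0) < λ/γ - μ q(0), then there exists a finite time t_c > 0 with q(t_c) = 0, and moreover t_c ≤ (1/μ) ln( ((λ+μ)(q(0) + 1/γ) + |p(0)|) / |p(0) + μ q(0) - λ/γ| ). -/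
/-- A solution of `f' = c f` on `[0, ∞)` is `f 0 * exp (c t)`. -/
theorem eq_mul_exp_of_hasDerivWithinAt_Ici {f : ℝ → ℝ} {c : ℝ}
    (hf : ∀ t : ℝ, 0 ≤ t → HasDerivWithinAt f (c * f t) (Set.Ici (0 : ℝ)) t)
    {t : ℝ} (ht : 0 ≤ t) : f t = f 0 * Real.exp (c * t) := by
  have hg : ∀ s : ℝ, 0 ≤ s →
      HasDerivWithinAt (fun x => f x * Real.exp (-(c * x))) 0 (Set.Ici (0 : ℝ)) s := by
    intro s hs
    have he : HasDerivAt (fun x : ℝ => Real.exp (-(c * x))) (Real.exp (-(c * s)) * -(c * 1)) s :=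
      ((hasDerivAt_id s).const_mul c).neg.exp
    exact ((hf s hs).mul he.hasDerivWithinAt).congr_deriv (by ring)
  have hconst := constant_of_has_deriv_right_zero
    (fun s hs => (hg s hs.1).continuousWithinAt.mono Set.Icc_subset_Ici_self)
    (fun s hs => (hg s hs.1).mono (Set.Ici_subset_Ici.2 hs.1)) t ⟨ht, le_rfl⟩
  simp only [mul_zero, neg_zero, Real.exp_zero, mul_one] at hconst
  rw [← hconst, mul_assoc, ← Real.exp_add, neg_add_cancel, Real.exp_zero, mul_one]

/-- supercritical data for the linear system
`p' = k - kγq`, `q' = p - βq` lead to `q` touching zero in finite time,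
with an explicit upper bound on the touching time. -/
theorem alignment_linear_finite_time_crossing
    (k γ β : ℝ) (hk : k < 0) (hγ : 0 < γ) (hβ : 0 ≤ β)
    (lam mu : ℝ)
    (hlam : lam = (β + Real.sqrt (β ^ 2 - 4 * k * γ)) / 2)
    (hmu : mu = (-β + Real.sqrt (β ^ 2 - 4 * k * γ)) / 2)
    (p q : ℝ → ℝ)
    (hodep : ∀ t : ℝ, 0 ≤ t →
      HasDerivWithinAt p (k - k * γ * q t) (Set.Ici (0 : ℝ)) t)
    (hodeq : ∀ t : ℝ, 0 ≤ t →
      HasDerivWithinAt q (p t - β * q t) (Set.Ici (0 : ℝ)) t)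
    (hq0 : 0 < q 0)
    (hp0 : p 0 < lam / γ - mu * q 0) :
    ∃ tc : ℝ, 0 < tc ∧ q tc = 0 ∧
      tc ≤ (1 / mu) * Real.log
        (((lam + mu) * (q 0 + 1 / γ) + |p 0|) / |p 0 + mu * q 0 - lam / γ|) := by
  have hkγ : k * γ < 0 := mul_neg_of_neg_of_pos hk hγ
  have hsq := Real.sq_sqrt (show 0 ≤ β ^ 2 - 4 * k * γ by nlinarith [sq_nonneg β])
  have hlt : β < Real.sqrt (β ^ 2 - 4 * k * γ) := Real.lt_sqrt_of_sq_lt (by linarith)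
  have hmu_pos : 0 < mu := by linarith
  have hlam_pos : 0 < lam := by linarith
  have hβ_eq : β = lam - mu := by linarith
  have hprod : k * γ = -(lam * mu) := by rw [hlam, hmu]; linarith
  have hk_eq : k = -(lam * mu) / γ := by rw [← hprod]; field_simp
  have hU : ∀ t : ℝ, 0 ≤ t → p t + mu * q t - lam / γ =
      (p 0 + mu * q 0 - lam / γ) * Real.exp (mu * t) := fun t ht =>
    eq_mul_exp_of_hasDerivWithinAt_Ici (f := fun s => p s + mu * q s - lam / γ)
      (fun s hs => (((hodep s hs).add ((hodeq s hs).const_mul mu)).sub_const _).congr_deriv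
        (by rw [hprod, hk_eq, hβ_eq]; ring)) ht
  have hV : ∀ t : ℝ, 0 ≤ t → p t - lam * q t + mu / γ =
      (p 0 - lam * q 0 + mu / γ) * Real.exp (-lam * t) := fun t ht =>
    eq_mul_exp_of_hasDerivWithinAt_Ici (f := fun s => p s - lam * q s + mu / γ)
      (fun s hs => (((hodep s hs).sub ((hodeq s hs).const_mul lam)).add_const _).congr_deriv
        (by rw [hprod, hk_eq, hβ_eq]; ring)) ht
  have hA : 0 < lam / γ - p 0 - mu * q 0 := by linarith
  have habs : |p 0 + mu * q 0 - lam / γ| = lam / γ - p 0 - mu * q 0 := by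
    rw [abs_of_neg (by linarith)]; ring
  rw [habs]
  have hNeq : (lam + mu) * (q 0 + 1 / γ) + |p 0| =
      lam * q 0 + mu * q 0 + lam / γ + mu / γ + |p 0| := by ring
  rw [hNeq]
  have hlq := mul_pos hlam_pos hq0
  have hmq := mul_pos hmu_pos hq0
  have hlγ := div_pos hlam_pos hγ
  have hmγ := div_pos hmu_pos hγ
  have hp_abs := neg_abs_le (p 0)
  set A := lam / γ - p 0 - mu * q 0 with hAdef
  set N := lam * q 0 + mu * q 0 + lam / γ + mu / γ + |p 0| with hN
  have hAN : A < N := by linarith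
  set T := 1 / mu * Real.log (N / A) with hT
  have hT_pos : 0 < T := mul_pos (one_div_pos.2 hmu_pos) (Real.log_pos ((one_lt_div hA).2 hAN))
  have hexp : A * Real.exp (mu * T) = N := by
    rw [hT, ← mul_assoc, mul_one_div_cancel hmu_pos.ne', one_mul,
      Real.exp_log (div_pos (hA.trans hAN) hA), mul_div_cancel₀ _ hA.ne']
  have hqT : q T < 0 := by
    have h1 := hU T hT_pos.le
    rw [show p 0 + mu * q 0 - lam / γ = -A by rw [hAdef]; ring, neg_mul, hexp] at h1
    have h2 := hV T hT_pos.le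
    have he0 := Real.exp_pos (-lam * T)
    have he1 : Real.exp (-lam * T) ≤ 1 := Real.exp_le_one_iff.2 (by nlinarith)
    have hdecay : -(lam * q 0 + |p 0|) ≤
        (p 0 - lam * q 0 + mu / γ) * Real.exp (-lam * T) := by
      nlinarith [mul_le_mul_of_nonneg_right he1 (show 0 ≤ lam * q 0 + |p 0| by positivity),
        mul_nonneg he0.le (show 0 ≤ p 0 - lam * q 0 + mu / γ + (lam * q 0 + |p 0|) by linarith)]
    have hneg : (lam + mu) * q T < 0 := by linarith
    exact (pos_iff_neg_of_mul_neg hneg).1 (by linarith)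
  have hcont : ContinuousOn q (Set.Icc 0 T) := fun s hs =>
    (hodeq s hs.1).continuousWithinAt.mono Set.Icc_subset_Ici_self
  obtain ⟨tc, htc, hzero⟩ := intermediate_value_Icc' hT_pos.le hcont ⟨hqT.le, hq0.le⟩
  refine ⟨tc, htc.1.lt_of_ne ?_, hzero, htc.2⟩
  rintro rfl
  exact hq0.ne' hzero
end

section
/- (Finite time breakdown for Euler–Poisson alignment along characteristics) Let k < 0, ν ≥ 0, c₂ > 0, 0 ≤ ψ_m, and let c, a : [0, ∞) → ℝ be continuous with c(t) ≤ c₂ and a(t) ≥ ψ_m for all t. Set λ_m = ((ν + ψ_m) + √((ν + ψ_m)² - 4kc₂))/2 and μ_m = (-(ν + ψ_m) + √((ν + ψ_m)² - 4kc₂))/2. Suppose ρ₀ ≥ 0 and G₀ < (λ_m/c₂) ρ₀ - μ_m. Then there do not exist differentiable functions ρ, G : [0, ∞) → ℝ with ρ(0) = ρ₀, G(0) = G₀ satisfying ρ'(t) = -ρ(t)(G(t) - ν - a(t)) and G'(t) = -G(t)(G(t) - ν - a(t)) + k(ρ(t) - c(t)) for all t ≥ 0; that is, the solution blows up in finite time.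 -/
/-- A function with nonpositive derivative on `[0, ∞)` stays below its initial value. -/
lemma le_initial_of_hasDerivWithinAt_nonpos {f f' : ℝ → ℝ}
    (hf : ∀ t : ℝ, 0 ≤ t → HasDerivWithinAt f (f' t) (Set.Ici 0) t)
    (hf' : ∀ t : ℝ, 0 ≤ t → f' t ≤ 0) {t : ℝ} (ht : 0 ≤ t) : f t ≤ f 0 := by
  have hanti : AntitoneOn f (Set.Ici 0) := by
    refine antitoneOn_of_hasDerivWithinAt_nonpos (f' := f') (convex_Ici 0)
      (fun x hx => (hf x hx).continuousWithinAt) (fun x hx => ?_) (fun x hx => ?_)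
    · exact (hf x (interior_subset hx)).mono interior_subset
    · exact hf' x (interior_subset hx)
  exact hanti Set.self_mem_Ici ht ht

/-- A continuous coefficient on `[0, ∞)` admits a positive integrating factor. -/
lemma exists_integrating_factor {g : ℝ → ℝ} (hg : ContinuousOn g (Set.Ici 0)) :
    ∃ E : ℝ → ℝ, E 0 = 1 ∧ (∀ t, 0 < E t) ∧
      ∀ t : ℝ, 0 ≤ t → HasDerivWithinAt E (E t * g t) (Set.Ici 0) t := by
  have hcont : Continuous (fun t => g (max t 0)) :=
    hg.comp_continuous (by fun_prop) (fun t => le_max_right t 0)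
  refine ⟨fun t => Real.exp (∫ s in (0 : ℝ)..t, g (max s 0)), by simp,
    fun t => Real.exp_pos _, fun t ht => ?_⟩
  have h := (hcont.integral_hasStrictDerivAt 0 t).hasDerivAt.exp.hasDerivWithinAt
    (s := Set.Ici 0)
  simpa only [max_eq_left ht] using h

/-- A downward parabola is nonpositive somewhere on `[0, ∞)`. -/
lemma exists_quadratic_nonpos {p : ℝ} (hp : 0 < p) (q : ℝ) :
    ∃ t : ℝ, 0 ≤ t ∧ 1 + q * t - p * t ^ 2 ≤ 0 := by
  have hfrac : 0 ≤ (|q| + 1) / p := by positivity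
  refine ⟨(|q| + 1) / p + 1, by linarith, ?_⟩
  have hmul : p * ((|q| + 1) / p + 1) = |q| + 1 + p := by field_simp
  have h_one : 1 ≤ (|q| + 1) / p + 1 := by linarith
  have hq := le_abs_self q
  generalize (|q| + 1) / p + 1 = t at *
  nlinarith


/-- Finite time breakdown for Euler–Poisson alignment along
characteristics: for `ρ' = -ρ(G - ν - a(t))`, `G' = -G(G - ν - a(t)) + k(ρ - c(t))`
with `c(t) ≤ c₂` and `a(t) ≥ ψ_m`, supercritical data `ρ₀ ≥ 0`,
`G₀ < (λ_m/c₂)ρ₀ - μ_m` admit no global differentiable solution on `[0, ∞)`. -/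
theorem alignment_finite_time_breakdown
    (k ν c₂ ψm : ℝ) (hk : k < 0) (hν : 0 ≤ ν) (hc₂ : 0 < c₂) (hψm : 0 ≤ ψm)
    (c a : ℝ → ℝ) (hc_cont : Continuous c) (ha_cont : Continuous a)
    (hc : ∀ t : ℝ, 0 ≤ t → c t ≤ c₂)
    (ha : ∀ t : ℝ, 0 ≤ t → ψm ≤ a t)
    (lamm mum : ℝ)
    (hlamm : lamm = ((ν + ψm) + Real.sqrt ((ν + ψm) ^ 2 - 4 * k * c₂)) / 2)
    (hmum : mum = (-(ν + ψm) + Real.sqrt ((ν + ψm) ^ 2 - 4 * k * c₂)) / 2)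
    (ρ₀ G₀ : ℝ) (hρ0 : 0 ≤ ρ₀) (hG0 : G₀ < (lamm / c₂) * ρ₀ - mum) :
    ¬ ∃ ρ G : ℝ → ℝ, ρ 0 = ρ₀ ∧ G 0 = G₀ ∧
      (∀ t : ℝ, 0 ≤ t →
        HasDerivWithinAt ρ (-(ρ t) * (G t - ν - a t)) (Set.Ici (0 : ℝ)) t) ∧
      (∀ t : ℝ, 0 ≤ t →
        HasDerivWithinAt G (-(G t) * (G t - ν - a t) + k * (ρ t - c t))
          (Set.Ici (0 : ℝ)) t) := by
  rintro ⟨ρ, G, hρ_init, hG_init, hρ, hG⟩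
  have hroots : lamm - mum = ν + ψm ∧ lamm * mum = -(k * c₂) ∧ 0 ≤ lamm ∧ 0 < mum := by
    have hneg : k * c₂ < 0 := mul_neg_of_neg_of_pos hk hc₂
    have hsq := Real.sq_sqrt (show 0 ≤ (ν + ψm) ^ 2 - 4 * k * c₂ by nlinarith [sq_nonneg (ν + ψm)])
    have hlt : ν + ψm < Real.sqrt ((ν + ψm) ^ 2 - 4 * k * c₂) :=
      Real.lt_sqrt_of_sq_lt (by linarith)
    rw [hlamm, hmum]
    refine ⟨by ring, by linarith, by linarith, by linarith⟩
  obtain ⟨hdiff, hprod, hlam_nonneg, hmu_pos⟩ := hroots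
  have hG_cont : ContinuousOn G (Set.Ici 0) := fun t ht => (hG t ht).continuousWithinAt
  obtain ⟨S, hS_init, hS_pos, hS⟩ :=
    exists_integrating_factor (g := fun t => G t - ν - a t) (by fun_prop)
  have hρS : ∀ t : ℝ, 0 ≤ t → ρ t * S t = ρ₀ := by
    intro t ht
    have hd : ∀ x : ℝ, 0 ≤ x → HasDerivWithinAt (fun x => ρ x * S x) 0 (Set.Ici 0) x :=
      fun x hx => ((hρ x hx).mul (hS x hx)).congr_deriv (by ring)
    have h := constant_of_has_deriv_right_zero (a := 0) (b := t)
      (fun x hx => (hd x hx.1).continuousWithinAt.mono Set.Icc_subset_Ici_self)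
      (fun x hx => (hd x hx.1).mono (Set.Ici_subset_Ici.mpr hx.1)) t ⟨ht, le_rfl⟩
    simpa [hρ_init, hS_init] using h
  set C := lamm / c₂ * ρ₀ with hC
  have hkC : k * ρ₀ = -(mum * C) := by
    rw [hC]
    field_simp
    linear_combination ρ₀ * hprod
  set z : ℝ → ℝ := fun t => G t * S t + mum * S t - C with hz
  have hz_init : z 0 < 0 := by
    simp only [hz, hG_init, hS_init]
    linarith
  have hz_deriv : ∀ t : ℝ, 0 ≤ t → HasDerivWithinAt z
      (k * ρ₀ - k * c t * S t + mum * (S t * (G t - ν - a t))) (Set.Ici 0) t := by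
    intro t ht
    refine ((((hG t ht).mul (hS t ht)).add ((hS t ht).const_mul mum)).sub_const C).congr_deriv ?_
    linear_combination k * hρS t ht
  have hz_growth : ∀ t : ℝ, 0 ≤ t →
      k * ρ₀ - k * c t * S t + mum * (S t * (G t - ν - a t)) ≤ mum * z t := by
    intro t ht
    have h1 : 0 ≤ -k * (c₂ - c t) * S t :=
      mul_nonneg (mul_nonneg (by linarith) (by linarith [hc t ht])) (hS_pos t).le
    have h2 : 0 ≤ mum * (S t * (a t - ψm)) :=
      mul_nonneg hmu_pos.le (mul_nonneg (hS_pos t).le (by linarith [ha t ht]))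
    have h3 : k * c₂ = -(mum * (ν + ψm + mum)) := by
      rw [← hdiff]
      linarith
    have h4 : k * c₂ * S t = -(mum * (ν + ψm + mum)) * S t := by rw [h3]
    simp only [hz]
    linarith
  have hz_exp : ∀ t : ℝ, 0 ≤ t → z t ≤ z 0 * Real.exp (mum * t) := by
    intro t ht
    have hd : ∀ x : ℝ, 0 ≤ x → HasDerivWithinAt (fun x => z x * Real.exp (-(mum * x)))
        (((k * ρ₀ - k * c x * S x + mum * (S x * (G x - ν - a x))) - mum * z x)
          * Real.exp (-(mum * x))) (Set.Ici 0) x := by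
      intro x hx
      have he := ((hasDerivAt_id x).const_mul mum).neg.exp.hasDerivWithinAt (s := Set.Ici 0)
      refine ((hz_deriv x hx).mul he).congr_deriv ?_
      simp only [id, Pi.neg_apply]
      ring
    have h := le_initial_of_hasDerivWithinAt_nonpos hd (fun x hx =>
      mul_nonpos_of_nonpos_of_nonneg (by linarith [hz_growth x hx]) (Real.exp_pos _).le) ht
    simp only [mul_zero, neg_zero, Real.exp_zero, mul_one, Real.exp_neg] at h
    rwa [← div_eq_mul_inv, div_le_iff₀ (Real.exp_pos _)] at h
  have hz_lin : ∀ t : ℝ, 0 ≤ t → z t ≤ z 0 * (1 + mum * t) := fun t ht =>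
    (hz_exp t ht).trans (mul_le_mul_of_nonpos_left
      (by linarith [Real.add_one_le_exp (mum * t)]) hz_init.le)
  have hS_le : ∀ t : ℝ, 0 ≤ t → S t ≤ 1 + (z 0 + C) * t - -(z 0 * mum / 2) * t ^ 2 := by
    intro t ht
    have hd : ∀ x : ℝ, 0 ≤ x → HasDerivWithinAt
        (fun x => S x - ((z 0 + C) * x - -(z 0 * mum / 2) * x ^ 2))
        (S x * (G x - ν - a x) - (z 0 * (1 + mum * x) + C)) (Set.Ici 0) x := by
      intro x hx
      have hq := (((hasDerivAt_id x).const_mul (z 0 + C)).sub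
        ((hasDerivAt_pow 2 x).const_mul (-(z 0 * mum / 2)))).hasDerivWithinAt (s := Set.Ici 0)
      refine ((hS x hx).sub hq).congr_deriv ?_
      push_cast
      ring
    have h := le_initial_of_hasDerivWithinAt_nonpos hd (fun x hx => by
      have h1 := hz_lin x hx
      have h2 : 0 ≤ S x * (a x - ψm) :=
        mul_nonneg (hS_pos x).le (by linarith [ha x hx])
      have h3 : 0 ≤ lamm * S x := mul_nonneg hlam_nonneg (hS_pos x).le
      have h4 : lamm * S x = (ν + ψm + mum) * S x := by rw [← hdiff]; ring
      have h5 : z x = G x * S x + mum * S x - C := rfl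
      linarith) ht
    simp only [hS_init] at h
    linarith
  obtain ⟨t, ht, hneg⟩ := exists_quadratic_nonpos (p := -(z 0 * mum / 2))
    (by linarith [mul_neg_of_neg_of_pos hz_init hmu_pos]) (z 0 + C)
  linarith [hS_pos t, hS_le t ht]
end
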